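/- arXiv:2304.02788 — 2 statements merged into one kernel-verified Lean document; each statement's English description precedes it below -/
import Mathlib

section
/- Let 𝕋^m and 𝕋^n be flat tori with metrics g = Σ g_{ij} dx^i ⊗ dx^j and h = Σ h_{ij} dy^i ⊗ dy^j given by positive definite symmetric matrices G and H, let f : 𝕋^m → 𝕋^n be smooth with f*[dy^j] = Σ_i P_i^j [dx^i] for an integer matrix P, assume the induced map f* on H¹ is nonzero, and set Φ := Σ h_{jk} P_i^j (*_g dx^i) ∧ dy^k and ‖P‖² := tr(ᵗP G^{-1} P H). Then ‖P‖^{-1} Φ is a σ₁-calibration; every map of the form f(x) = ᵗP x + a with a ∈ 𝕋^n is (σ₁, ‖P‖^{-1}Φ)-calibrated; and f minimizes the 2-energy E₂ in its homotopy class if and only if f(x) = ᵗP x + a for some a. -/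
/-!
Flat tori `𝕋^k = ℝ^k/ℤ^k` are treated via `ℤ^k`-periodic lifts: a smooth map
`f : 𝕋^m → 𝕋^n` is represented by a smooth map `F : ℝ^m → ℝ^n` such that
`F(x + k) − F(x) ∈ ℤ^n` for all `k ∈ ℤ^m`.  The flat metrics `g, h` are given by positive
definite symmetric matrices `G, H`; the induced map on `H¹` is the integer matrix `P` with
`F(x + eᵢ) = F(x) + ᵗP eᵢ`, and the volume form of `g` is `√(det G) dx¹ ∧ ⋯ ∧ dxᵐ`.
For a linear map with matrix `A = dF_x` (size `n × m`), one has
`σ₁(f)(x) = |dF_x| = √(tr(G⁻¹ ᵗA H A))`, and the `m`-form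
`Φ = ∑ h_{jk} P_i^j (*_g dx^i) ∧ dy^k` satisfies `(1,f)^*Φ = tr(G⁻¹ P H A) vol_g`.
-/

noncomputable section
open MeasureTheory
namespace Paper

abbrev EucM (m : ℕ) := EuclideanSpace ℝ (Fin m)

/-- The integer vector `kv` as an element of `ℝ^m`. -/
def intVec {m : ℕ} (kv : Fin m → ℤ) : EucM m :=
  (EuclideanSpace.equiv (Fin m) ℝ).symm fun i => (kv i : ℝ)

/-- `F : ℝ^m → ℝ^n` descends to a map of tori `𝕋^m → 𝕋^n`. -/
def IsTorusMap {m n : ℕ} (F : EucM m → EucM n) : Prop :=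
  ∀ (x : EucM m) (kv : Fin m → ℤ), ∃ kv' : Fin n → ℤ,
    F (x + intVec kv) = F x + intVec kv'

/-- The torus map with lift `F` induces the matrix `P` on `H¹` (i.e.
`f^*[dy^j] = ∑_i P_i^j [dx^i]`), equivalently `F(x + eᵢ) = F(x) + ᵗP eᵢ`. -/
def HasPeriodMatrix {m n : ℕ} (F : EucM m → EucM n) (P : Matrix (Fin m) (Fin n) ℤ) :
    Prop :=
  ∀ (x : EucM m) (i : Fin m),
    F (x + intVec fun j => if j = i then 1 else 0) = F x + intVec fun j => P i j

/-- Smooth homotopy of torus maps (through torus maps). -/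
def TorusHomotopic {m n : ℕ} (F₀ F₁ : EucM m → EucM n) : Prop :=
  ∃ K : ℝ × EucM m → EucM n, ContDiff ℝ (⊤ : ℕ∞) K ∧
    (∀ t : ℝ, IsTorusMap fun x => K (t, x)) ∧
    (∀ x, K (0, x) = F₀ x) ∧ (∀ x, K (1, x) = F₁ x)

/-- The Jacobian matrix of `F` at `x`. -/
def Jac {m n : ℕ} (F : EucM m → EucM n) (x : EucM m) : Matrix (Fin n) (Fin m) ℝ :=
  Matrix.of fun i j => fderiv ℝ F x (EuclideanSpace.single j 1) i

/-- The fundamental domain `[0,1]^m` of `𝕋^m`. -/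
def unitCube (m : ℕ) : Set (EucM m) := {x | ∀ i, 0 ≤ x i ∧ x i ≤ 1}

/-- `|A|² = tr(G⁻¹ ᵗA H A)`, the squared Hilbert–Schmidt norm of `A : ℝ^m → ℝ^n` with
respect to the flat metrics given by `G` and `H`. -/
def hsSq {m n : ℕ} (G : Matrix (Fin m) (Fin m) ℝ) (H : Matrix (Fin n) (Fin n) ℝ)
    (A : Matrix (Fin n) (Fin m) ℝ) : ℝ :=
  Matrix.trace (G⁻¹ * A.transpose * H * A)

/-- `(1_{𝕋^m}, f)^*Φ / vol_g = tr(G⁻¹ P H dF_x)` for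
`Φ = ∑ h_{jk} P_i^j (*_g dx^i) ∧ dy^k`. -/
def calibPair {m n : ℕ} (G : Matrix (Fin m) (Fin m) ℝ) (H : Matrix (Fin n) (Fin n) ℝ)
    (Pr : Matrix (Fin m) (Fin n) ℝ) (A : Matrix (Fin n) (Fin m) ℝ) : ℝ :=
  Matrix.trace (G⁻¹ * Pr * H * A)

/-- `‖P‖ = √(tr(ᵗP G⁻¹ P H))`. -/
def periodNorm {m n : ℕ} (G : Matrix (Fin m) (Fin m) ℝ) (H : Matrix (Fin n) (Fin n) ℝ)
    (Pr : Matrix (Fin m) (Fin n) ℝ) : ℝ :=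
  Real.sqrt (Matrix.trace (Pr.transpose * G⁻¹ * Pr * H))

/-- The `2`-energy `E₂(f) = ∫_{𝕋^m} |df|² vol_g` of a torus map. -/
def torusEnergy₂ {m n : ℕ} (G : Matrix (Fin m) (Fin m) ℝ) (H : Matrix (Fin n) (Fin n) ℝ)
    (F : EucM m → EucM n) : ℝ :=
  Real.sqrt G.det * ∫ x in unitCube m, hsSq G H (Jac F x) ∂volume

/-- The affine map `x ↦ ᵗP x + a`. -/
def affineTorusMap {m n : ℕ} (Pr : Matrix (Fin m) (Fin n) ℝ) (a : EucM n)
    (x : EucM m) : EucM n :=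
  Matrix.toEuclideanLin Pr.transpose x + a

section Algebra
open scoped MatrixOrder

variable {m n : ℕ} {G : Matrix (Fin m) (Fin m) ℝ} {H : Matrix (Fin n) (Fin n) ℝ}

theorem exists_isUnit_transpose_mul_self {k : ℕ} {M : Matrix (Fin k) (Fin k) ℝ}
    (hM : M.PosDef) : ∃ S : Matrix (Fin k) (Fin k) ℝ, IsUnit S ∧ M = S.transpose * S := by
  obtain ⟨S, hS, h⟩ := CStarAlgebra.isStrictlyPositive_iff_eq_star_mul_self.mp
    hM.isStrictlyPositive
  rw [Matrix.star_eq_conjTranspose, Matrix.conjTranspose_eq_transpose_of_trivial] at h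
  exact ⟨S, hS, h⟩

theorem exists_hsSq_eq_trace (hG : G.PosDef) (hH : H.PosDef) :
    ∃ S : Matrix (Fin m) (Fin m) ℝ, ∃ T : Matrix (Fin n) (Fin n) ℝ, IsUnit S ∧ IsUnit T ∧
      ∀ A, hsSq G H A =
        Matrix.trace ((T * A * S.transpose).conjTranspose * (T * A * S.transpose)) := by
  obtain ⟨S, hS, hGS⟩ := exists_isUnit_transpose_mul_self hG.inv
  obtain ⟨T, hT, hHT⟩ := exists_isUnit_transpose_mul_self hH
  refine ⟨S, T, hS, hT, fun A => ?_⟩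
  rw [hsSq, hGS, hHT, Matrix.conjTranspose_eq_transpose_of_trivial]
  simp only [Matrix.transpose_mul, Matrix.transpose_transpose]
  rw [← Matrix.mul_assoc (S * _), Matrix.trace_mul_comm _ S.transpose]
  simp only [Matrix.mul_assoc]

theorem hsSq_nonneg (hG : G.PosDef) (hH : H.PosDef) (A : Matrix (Fin n) (Fin m) ℝ) :
    0 ≤ hsSq G H A := by
  obtain ⟨S, T, -, -, h⟩ := exists_hsSq_eq_trace hG hH
  rw [h]
  exact (Matrix.posSemidef_conjTranspose_mul_self _).trace_nonneg

theorem hsSq_eq_zero (hG : G.PosDef) (hH : H.PosDef) {A : Matrix (Fin n) (Fin m) ℝ}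
    (hA : hsSq G H A = 0) : A = 0 := by
  obtain ⟨S, T, hS, hT, h⟩ := exists_hsSq_eq_trace hG hH
  rw [h, Matrix.trace_conjTranspose_mul_self_eq_zero_iff] at hA
  have hS' : IsUnit S.transpose.det := by
    rw [Matrix.det_transpose]; exact (Matrix.isUnit_iff_isUnit_det S).1 hS
  have hT' := (Matrix.isUnit_iff_isUnit_det T).1 hT
  have h1 : T⁻¹ * (T * A * S.transpose) * S.transpose⁻¹ = A := by
    rw [Matrix.mul_assoc T A, Matrix.nonsing_inv_mul_cancel_left _ _ hT',
      Matrix.mul_nonsing_inv_cancel_right _ _ hS']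
  rw [← h1, hA]; simp

theorem calibPair_transpose (A : Matrix (Fin n) (Fin m) ℝ) :
    calibPair G H A.transpose A = hsSq G H A := rfl

theorem calibPair_transpose_comm (hG : G.PosDef) (hH : H.PosDef)
    (A B : Matrix (Fin n) (Fin m) ℝ) :
    calibPair G H A.transpose B = calibPair G H B.transpose A := by
  have hG' : G⁻¹.transpose = G⁻¹ := hG.inv.isHermitian
  have hH' : H.transpose = H := hH.isHermitian
  rw [calibPair, ← Matrix.trace_transpose]
  simp only [Matrix.transpose_mul, hG', hH', Matrix.transpose_transpose]
  rw [calibPair, ← Matrix.mul_assoc, ← Matrix.mul_assoc, Matrix.trace_mul_comm]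
  simp only [Matrix.mul_assoc]

theorem hsSq_add_smul (hG : G.PosDef) (hH : H.PosDef) (t : ℝ)
    (A B : Matrix (Fin n) (Fin m) ℝ) :
    hsSq G H (A + t • B) =
      hsSq G H A + 2 * t * calibPair G H A.transpose B + t ^ 2 * hsSq G H B := by
  have h := calibPair_transpose_comm hG hH A B
  simp only [calibPair, hsSq] at *
  simp only [Matrix.transpose_add, Matrix.transpose_smul, Matrix.mul_add, Matrix.add_mul,
    Matrix.mul_smul, Matrix.smul_mul, Matrix.trace_add, Matrix.trace_smul, smul_eq_mul, ← h]
  ring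

theorem periodNorm_eq (Q : Matrix (Fin m) (Fin n) ℝ) :
    periodNorm G H Q = Real.sqrt (hsSq G H Q.transpose) := by
  rw [periodNorm, hsSq, Matrix.transpose_transpose, Matrix.mul_assoc, Matrix.mul_assoc,
    Matrix.trace_mul_comm]
  simp only [Matrix.mul_assoc]

theorem calibPair_le (hG : G.PosDef) (hH : H.PosDef) (Q : Matrix (Fin m) (Fin n) ℝ)
    (A : Matrix (Fin n) (Fin m) ℝ) :
    calibPair G H Q A ≤ periodNorm G H Q * Real.sqrt (hsSq G H A) := by
  rw [periodNorm_eq, ← Real.sqrt_mul (hsSq_nonneg hG hH _)]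
  apply Real.le_sqrt_of_sq_le
  have h := discrim_le_zero (a := hsSq G H A) (b := 2 * calibPair G H Q A)
    (c := hsSq G H Q.transpose) fun t => by
      have := hsSq_nonneg hG hH (Q.transpose + t • A)
      rw [hsSq_add_smul hG hH, Matrix.transpose_transpose] at this
      linarith
  rw [discrim] at h
  linarith

theorem calibPair_eq_sum (Q : Matrix (Fin m) (Fin n) ℝ) (A : Matrix (Fin n) (Fin m) ℝ) :
    calibPair G H Q A = ∑ i, ∑ j, (G⁻¹ * Q * H) i j * A j i := by
  simp only [calibPair, Matrix.trace, Matrix.diag, Matrix.mul_apply (M := G⁻¹ * Q * H)]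

end Algebra

section Cube

variable {m n : ℕ}

theorem toLp_preimage_unitCube :
    (WithLp.toLp 2 : (Fin m → ℝ) → EucM m) ⁻¹' unitCube m = Set.Icc 0 1 := by
  ext x
  simp [unitCube, Pi.le_def, forall_and]

theorem volume_unitCube : volume (unitCube m) = 1 := by
  have h := (PiLp.volume_preserving_toLp (Fin m)).measure_preimage_emb
    (MeasurableEquiv.toLp 2 (Fin m → ℝ)).measurableEmbedding (unitCube m)
  rw [← h, toLp_preimage_unitCube, Real.volume_Icc_pi]
  simp

theorem unitCube_eq_image :
    unitCube m = (EuclideanSpace.equiv (Fin m) ℝ).symm '' Set.Icc 0 1 := by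
  rw [ContinuousLinearEquiv.image_symm_eq_preimage]
  ext x
  simp [unitCube, Pi.le_def, forall_and]

theorem isCompact_unitCube : IsCompact (unitCube m) := by
  rw [unitCube_eq_image]
  exact isCompact_Icc.image (ContinuousLinearEquiv.continuous _)

theorem convex_unitCube : Convex ℝ (unitCube m) := by
  rw [unitCube_eq_image]
  exact (convex_Icc 0 1).linear_image (EuclideanSpace.equiv (Fin m) ℝ).symm.toLinearMap

theorem nonempty_interior_unitCube : (interior (unitCube m)).Nonempty := by
  by_contra h
  have h0 := convex_unitCube.addHaar_frontier (volume : Measure (EucM m))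
  rw [isCompact_unitCube.isClosed.frontier_eq, Set.not_nonempty_iff_eq_empty.1 h,
    Set.sdiff_empty, volume_unitCube] at h0
  exact one_ne_zero h0

theorem unitCube_subset_closure_interior :
    unitCube m ⊆ closure (interior (unitCube m)) := by
  rw [convex_unitCube.closure_interior_eq_closure_of_nonempty_interior nonempty_interior_unitCube]
  exact subset_closure

theorem integral_fderiv_single_eq_zero {φ : EucM m → ℝ} (hφ : ContDiff ℝ 1 φ)
    (hper : ∀ x i, φ (x + EuclideanSpace.single i 1) = φ x) (j : Fin m) :
    ∫ x in unitCube m, fderiv ℝ φ x (EuclideanSpace.single j 1) = 0 := by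
  rcases m with _ | m
  · exact j.elim0
  rw [← (PiLp.volume_preserving_toLp (Fin (m + 1))).setIntegral_preimage_emb
    (MeasurableEquiv.toLp 2 (Fin (m + 1) → ℝ)).measurableEmbedding, toLp_preimage_unitCube]
  set L : (Fin (m + 1) → ℝ) →L[ℝ] EucM (m + 1) :=
    (EuclideanSpace.equiv (Fin (m + 1)) ℝ).symm.toContinuousLinearMap with hL
  have hLe : ∀ y, L y = WithLp.toLp 2 y := fun y => rfl
  have hφ' : Continuous (fderiv ℝ φ) := hφ.continuous_fderiv one_ne_zero
  have hsum : ∀ x, ∑ i, (if i = j then (fderiv ℝ φ (L x)).comp L else 0) (Pi.single i 1) =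
      fderiv ℝ φ (WithLp.toLp 2 x) (EuclideanSpace.single j 1) := by
    intro x
    rw [Finset.sum_eq_single j (fun i _ hi => by simp [hi]) (by simp)]
    simp [hLe, EuclideanSpace.single]
  have hdiv := integral_divergence_of_hasFDerivAt_off_countable' (E := ℝ)
    (0 : Fin (m + 1) → ℝ) 1 zero_le_one
    (fun i x => if i = j then φ (L x) else 0)
    (fun i x => if i = j then (fderiv ℝ φ (L x)).comp L else 0) ∅ Set.countable_empty
    (fun i => by
      have := hφ.continuous
      split_ifs <;> fun_prop)
    (fun x _ i => by
      split_ifs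
      · exact ((hφ.differentiable one_ne_zero _).hasFDerivAt).comp x L.hasFDerivAt
      · exact hasFDerivAt_const _ _)
    (by
      simp only [hsum]
      refine Continuous.integrableOn_Icc ?_
      exact (hφ'.comp L.continuous).clm_apply continuous_const)
  simp only [hsum] at hdiv
  rw [hdiv]
  refine Finset.sum_eq_zero fun i _ => sub_eq_zero.2 ?_
  congr 1
  ext x
  split_ifs
  · have : L (i.insertNth 1 x) = L (i.insertNth 0 x) + EuclideanSpace.single i 1 := by
      ext k
      rcases Fin.eq_self_or_eq_succAbove i k with rfl | ⟨k, rfl⟩ <;>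
        simp [hLe]
    simp [this, hper]
  · rfl

end Cube

section Lattice

variable {m n : ℕ}

theorem intVec_single (i : Fin m) :
    intVec (fun j => if j = i then 1 else 0) = EuclideanSpace.single i (1 : ℝ) := by
  ext j
  simp [intVec]

theorem add_intVec_of_periodic {E : Type*} {u : EucM m → E}
    (hu : ∀ x i, u (x + EuclideanSpace.single i 1) = u x) (k : Fin m → ℤ) (x : EucM m) :
    u (x + intVec k) = u x := by
  have hz : ∀ (i : Fin m) (c : ℤ) (x : EucM m),
      u (x + EuclideanSpace.single i (c : ℝ)) = u x := by
    intro i c x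
    have hp : Function.Periodic u (EuclideanSpace.single i (1 : ℝ)) := fun x => hu x i
    have hc : c • EuclideanSpace.single i (1 : ℝ) = EuclideanSpace.single i (c : ℝ) := by
      ext j
      simp
    rw [← hc]
    exact hp.zsmul c x
  have hs : ∀ (s : Finset (Fin m)) (x : EucM m),
      u (x + ∑ i ∈ s, EuclideanSpace.single i (k i : ℝ)) = u x := by
    intro s
    induction s using Finset.induction_on with
    | empty => simp
    | insert i s hi ih =>
      intro x
      rw [Finset.sum_insert hi, ← add_assoc, ih, hz]
  have hk : intVec k = ∑ i, EuclideanSpace.single i (k i : ℝ) := by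
    ext j
    simp [intVec, Pi.single_apply]
  rw [hk, hs]

theorem hasPeriodMatrix_affineTorusMap (P : Matrix (Fin m) (Fin n) ℤ) (a : EucM n) :
    HasPeriodMatrix (affineTorusMap (P.map Int.cast) a) P := by
  intro x i
  ext j
  simp [affineTorusMap, intVec, Matrix.mulVec, dotProduct]
  ring

theorem affineTorusMap_add_intVec (P : Matrix (Fin m) (Fin n) ℤ) (a : EucM n) (x : EucM m)
    (k : Fin m → ℤ) :
    affineTorusMap (P.map Int.cast) a (x + intVec k) =
      affineTorusMap (P.map Int.cast) a x + intVec (P.transpose.mulVec k) := by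
  ext j
  simp [affineTorusMap, intVec, Matrix.mulVec, dotProduct]
  ring

theorem sub_affineTorusMap_periodic {F : EucM m → EucM n} {P : Matrix (Fin m) (Fin n) ℤ}
    (hF : HasPeriodMatrix F P) (a : EucM n) (x : EucM m) (i : Fin m) :
    (F - affineTorusMap (P.map Int.cast) a) (x + EuclideanSpace.single i 1) =
      (F - affineTorusMap (P.map Int.cast) a) x := by
  simp only [Pi.sub_apply]
  rw [← intVec_single, hF, hasPeriodMatrix_affineTorusMap P a]
  abel

theorem HasPeriodMatrix.add_intVec {F : EucM m → EucM n} {P : Matrix (Fin m) (Fin n) ℤ}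
    (hF : HasPeriodMatrix F P) (x : EucM m) (k : Fin m → ℤ) :
    F (x + intVec k) = F x + intVec (P.transpose.mulVec k) := by
  have h := add_intVec_of_periodic (sub_affineTorusMap_periodic hF 0) k x
  simp only [Pi.sub_apply] at h
  rw [affineTorusMap_add_intVec, sub_eq_iff_eq_add] at h
  rw [h]
  abel

theorem HasPeriodMatrix.of_torusHomotopic {F F' : EucM m → EucM n}
    {P : Matrix (Fin m) (Fin n) ℤ} (hF : HasPeriodMatrix F P) (h : TorusHomotopic F F') :
    HasPeriodMatrix F' P := by
  obtain ⟨K, hK, hKt, hK0, hK1⟩ := h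
  intro x i
  have hshift : ∀ t, ∃ k : Fin n → ℤ,
      K (t, x + intVec fun j => if j = i then 1 else 0) = K (t, x) + intVec k := fun t =>
    hKt t x _
  choose k hk using hshift
  have hcont := hK.continuous
  have hconst : k 1 = k 0 := by
    ext j
    have hj : Continuous fun t => k t j := by
      rw [Int.isClosedEmbedding_coe_real.isEmbedding.continuous_iff]
      have : (Int.cast ∘ fun t => k t j : ℝ → ℝ) =
          fun t => (K (t, x + intVec fun j => if j = i then 1 else 0) - K (t, x)) j := by
        ext t
        rw [hk t]
        simp [intVec]
      rw [this]
      fun_prop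
    exact PreconnectedSpace.constant inferInstance hj
  have h0 := hk 0
  rw [hK0, hK0, hF, add_right_inj] at h0
  rw [← hK1, ← hK1, hk, hconst, ← h0]

end Lattice

section Energy

variable {m n : ℕ} {G : Matrix (Fin m) (Fin m) ℝ} {H : Matrix (Fin n) (Fin n) ℝ}

theorem contDiff_affineTorusMap {k : WithTop ℕ∞} (Q : Matrix (Fin m) (Fin n) ℝ) (a : EucM n) :
    ContDiff ℝ k (affineTorusMap Q a) :=
  (LinearMap.toContinuousLinearMap (Matrix.toEuclideanLin Q.transpose)).contDiff.add
    contDiff_const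

theorem jac_affineTorusMap (Q : Matrix (Fin m) (Fin n) ℝ) (a : EucM n) (x : EucM m) :
    Jac (affineTorusMap Q a) x = Q.transpose := by
  have h : HasFDerivAt (affineTorusMap Q a)
      (LinearMap.toContinuousLinearMap (Matrix.toEuclideanLin Q.transpose)) x :=
    (LinearMap.toContinuousLinearMap (Matrix.toEuclideanLin Q.transpose)).hasFDerivAt.add_const a
  ext i j
  rw [Jac, h.fderiv]
  simp

theorem jac_add {F u : EucM m → EucM n} {x : EucM m} (hF : DifferentiableAt ℝ F x)
    (hu : DifferentiableAt ℝ u x) :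
    Jac (F + u) x = Jac F x + Jac u x := by
  ext i j
  simp [Jac, fderiv_add hF hu]

theorem continuous_jac {u : EucM m → EucM n} (hu : ContDiff ℝ 1 u) : Continuous (Jac u) := by
  have := hu.continuous_fderiv one_ne_zero
  refine continuous_matrix fun i j => ?_
  simp only [Jac, Matrix.of_apply]
  fun_prop

theorem fderiv_eq_zero_of_jac_eq_zero {u : EucM m → EucM n} {x : EucM m} (h : Jac u x = 0) :
    fderiv ℝ u x = 0 := by
  refine ContinuousLinearMap.coe_injective
    ((EuclideanSpace.basisFun (Fin m) ℝ).toBasis.ext fun j => ?_)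
  ext i
  simpa [Jac] using congrFun (congrFun h i) j

theorem continuous_hsSq_jac {u : EucM m → EucM n} (hu : ContDiff ℝ 1 u) :
    Continuous fun x => hsSq G H (Jac u x) := by
  have := continuous_jac hu
  unfold hsSq
  fun_prop

theorem integral_calibPair_jac_eq_zero {u : EucM m → EucM n} (hu : ContDiff ℝ 1 u)
    (hper : ∀ x i, u (x + EuclideanSpace.single i 1) = u x) (Q : Matrix (Fin m) (Fin n) ℝ) :
    ∫ x in unitCube m, calibPair G H Q (Jac u x) = 0 := by
  have hint : ∀ i j, IntegrableOn (fun x => (G⁻¹ * Q * H) i j * Jac u x j i) (unitCube m) := by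
    intro i j
    have hc := ((continuous_jac hu).matrix_elem j i).const_mul ((G⁻¹ * Q * H) i j)
    exact hc.continuousOn.integrableOn_compact isCompact_unitCube
  have hzero : ∀ i j, ∫ x in unitCube m, Jac u x j i = 0 := by
    intro i j
    have hd : ∀ x, HasFDerivAt (fun y => u y j)
        ((EuclideanSpace.proj j : EucM n →L[ℝ] ℝ).comp (fderiv ℝ u x)) x := fun x =>
      (EuclideanSpace.proj j : EucM n →L[ℝ] ℝ).hasFDerivAt.comp x
        (hu.differentiable one_ne_zero x).hasFDerivAt
    have h := integral_fderiv_single_eq_zero (φ := fun x => u x j) (by fun_prop)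
      (fun x i => by rw [hper]) i
    simp only [(hd _).fderiv] at h
    exact h
  simp only [calibPair_eq_sum]
  rw [integral_finsetSum _ fun i _ => integrable_finsetSum _ fun j _ => hint i j]
  refine Finset.sum_eq_zero fun i _ => ?_
  rw [integral_finsetSum _ fun j _ => hint i j]
  refine Finset.sum_eq_zero fun j _ => ?_
  rw [integral_const_mul, hzero, mul_zero]

theorem torusEnergy₂_affineTorusMap_add (hG : G.PosDef) (hH : H.PosDef)
    (Q : Matrix (Fin m) (Fin n) ℝ) (a : EucM n) {u : EucM m → EucM n} (hu : ContDiff ℝ 1 u)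
    (hper : ∀ x i, u (x + EuclideanSpace.single i 1) = u x) :
    torusEnergy₂ G H (affineTorusMap Q a + u) =
      Real.sqrt G.det * (hsSq G H Q.transpose + ∫ x in unitCube m, hsSq G H (Jac u x)) := by
  have hexp : ∀ x, hsSq G H (Jac (affineTorusMap Q a + u) x) =
      hsSq G H Q.transpose + 2 * calibPair G H Q (Jac u x) + hsSq G H (Jac u x) := by
    intro x
    rw [jac_add ((contDiff_affineTorusMap Q a).differentiable one_ne_zero x)
      (hu.differentiable one_ne_zero x), jac_affineTorusMap]
    have := hsSq_add_smul hG hH 1 Q.transpose (Jac u x)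
    rw [one_smul, Matrix.transpose_transpose] at this
    linarith
  have hcalib : Continuous fun x => calibPair G H Q (Jac u x) := by
    have := continuous_jac hu
    unfold calibPair
    fun_prop
  have hint : ∀ {f : EucM m → ℝ}, Continuous f → IntegrableOn f (unitCube m) := fun hf =>
    hf.continuousOn.integrableOn_compact isCompact_unitCube
  simp only [torusEnergy₂, hexp]
  rw [integral_add (hint (by fun_prop)) (hint (continuous_hsSq_jac hu)),
    integral_add (hint (by fun_prop)) (hint (by fun_prop)), integral_const_mul,
    integral_calibPair_jac_eq_zero hu hper, setIntegral_const, measureReal_def, volume_unitCube]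
  simp

theorem eq_const_of_integral_hsSq_jac_nonpos (hG : G.PosDef) (hH : H.PosDef)
    {u : EucM m → EucM n} (hu : ContDiff ℝ 1 u)
    (hper : ∀ x i, u (x + EuclideanSpace.single i 1) = u x)
    (hint : ∫ x in unitCube m, hsSq G H (Jac u x) ≤ 0) (x : EucM m) : u x = u 0 := by
  have hnonneg : ∀ x, 0 ≤ hsSq G H (Jac u x) := fun x => hsSq_nonneg hG hH _
  have hc := continuous_hsSq_jac (G := G) (H := H) hu
  have hae := (setIntegral_eq_zero_iff_of_nonneg_ae (Filter.Eventually.of_forall hnonneg)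
    (hc.continuousOn.integrableOn_compact isCompact_unitCube)).1
    (hint.antisymm (integral_nonneg hnonneg))
  have hzero := Measure.eqOn_of_ae_eq hae hc.continuousOn continuousOn_const
    unitCube_subset_closure_interior
  have hd := hu.differentiable one_ne_zero
  have hcube : ∀ y ∈ unitCube m, u y = u 0 := fun y hy =>
    convex_unitCube.is_const_of_fderivWithin_eq_zero (𝕜 := ℝ) hd.differentiableOn
      (fun z hz => by
        have huniq := (uniqueDiffOn_convex convex_unitCube nonempty_interior_unitCube) z hz
        rw [(hd z).fderivWithin huniq]
        exact fderiv_eq_zero_of_jac_eq_zero (hsSq_eq_zero hG hH (hzero hz)))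
      hy (by simp [unitCube])
  rw [← add_intVec_of_periodic hper (fun i => -⌊x i⌋) x]
  refine hcube _ fun i => ?_
  have h1 := Int.floor_le (x i)
  have h2 := (Int.lt_floor_add_one (x i)).le
  simp only [intVec, PiLp.add_apply, Int.cast_neg, PiLp.continuousLinearEquiv_symm_apply]
  constructor <;> linarith

theorem torusHomotopic_of_hasPeriodMatrix {F F' : EucM m → EucM n}
    {P : Matrix (Fin m) (Fin n) ℤ} (hF : ContDiff ℝ (⊤ : ℕ∞) F) (hF' : ContDiff ℝ (⊤ : ℕ∞) F')
    (hP : HasPeriodMatrix F P) (hP' : HasPeriodMatrix F' P) : TorusHomotopic F F' := by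
  refine ⟨fun p => (1 - p.1) • F p.2 + p.1 • F' p.2, by fun_prop, fun t x k => ?_, by simp, by simp⟩
  refine ⟨P.transpose.mulVec k, ?_⟩
  simp only [hP.add_intVec, hP'.add_intVec, smul_add]
  module

end Energy

/-- Let `𝕋^m, 𝕋^n` be flat tori with metrics given by positive definite
symmetric matrices `G, H`, and let `f : 𝕋^m → 𝕋^n` be a smooth map (with lift `F`) whose
induced map on `H¹` is given by the nonzero integer matrix `P`.  With
`Φ = ∑ h_{jk} P_i^j (*_g dx^i) ∧ dy^k` and `‖P‖² = tr(ᵗP G⁻¹ P H)`: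
(1) `‖P‖⁻¹ Φ` is a `σ₁`-calibration, i.e. pointwise
    `tr(G⁻¹ P H A) ≤ ‖P‖ |A|` for every differential `A`;
(2) every map of the form `f(x) = ᵗP x + a` is `(σ₁, ‖P‖⁻¹Φ)`-calibrated;
(3) `f` minimizes `E₂` in its homotopy class iff `f(x) = ᵗP x + a` for some `a`. -/
theorem torus_calibration_and_energy_minimizers
    {m n : ℕ}
    (G : Matrix (Fin m) (Fin m) ℝ) (hG : G.PosDef)
    (H : Matrix (Fin n) (Fin n) ℝ) (hH : H.PosDef)
    (P : Matrix (Fin m) (Fin n) ℤ) (hP : P ≠ 0)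
    (F : EucM m → EucM n) (hF : ContDiff ℝ (⊤ : ℕ∞) F) (hFt : IsTorusMap F)
    (hFP : HasPeriodMatrix F P) :
    -- (1) `‖P‖⁻¹Φ` is a `σ₁`-calibration
    (∀ A : Matrix (Fin n) (Fin m) ℝ,
      calibPair G H (P.map Int.cast) A
        ≤ periodNorm G H (P.map Int.cast) * Real.sqrt (hsSq G H A)) ∧
    -- (2) the affine maps with period matrix `P` are `(σ₁, ‖P‖⁻¹Φ)`-calibrated
    (∀ (a : EucM n) (x : EucM m),
      calibPair G H (P.map Int.cast) (Jac (affineTorusMap (P.map Int.cast) a) x)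
        = periodNorm G H (P.map Int.cast) *
            Real.sqrt (hsSq G H (Jac (affineTorusMap (P.map Int.cast) a) x))) ∧
    -- (3) `f` minimizes `E₂` in its homotopy class iff it is affine
    ((∀ F' : EucM m → EucM n, ContDiff ℝ (⊤ : ℕ∞) F' → IsTorusMap F' → TorusHomotopic F F' →
        torusEnergy₂ G H F ≤ torusEnergy₂ G H F') ↔
      ∃ a : EucM n, ∀ x, F x = affineTorusMap (P.map Int.cast) a x) := by
  have haff : ∀ a, ContDiff ℝ (⊤ : ℕ∞) (affineTorusMap (P.map Int.cast) a) := fun a =>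
    contDiff_affineTorusMap _ a
  have hsub : ∀ {F' : EucM m → EucM n}, ContDiff ℝ (⊤ : ℕ∞) F' →
      ContDiff ℝ 1 (F' - affineTorusMap (P.map Int.cast) 0) := fun hF' =>
    (hF'.sub (haff 0)).of_le (by norm_cast)
  have henergy : ∀ {F' : EucM m → EucM n}, ContDiff ℝ (⊤ : ℕ∞) F' → HasPeriodMatrix F' P →
      torusEnergy₂ G H F' = Real.sqrt G.det * (hsSq G H (P.map Int.cast).transpose +
        ∫ x in unitCube m, hsSq G H (Jac (F' - affineTorusMap (P.map Int.cast) 0) x)) := by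
    intro F' hF' hP'
    have h := torusEnergy₂_affineTorusMap_add hG hH (P.map Int.cast) 0
      (hsub hF') (sub_affineTorusMap_periodic hP' 0)
    rwa [add_sub_cancel] at h
  have hsqrt : 0 < Real.sqrt G.det := Real.sqrt_pos.2 hG.det_pos
  have haffine : ∀ a, torusEnergy₂ G H (affineTorusMap (P.map Int.cast) a) =
      Real.sqrt G.det * hsSq G H (P.map Int.cast).transpose := by
    intro a
    have h := torusEnergy₂_affineTorusMap_add hG hH (P.map Int.cast) a (u := 0)
      contDiff_const (fun _ _ => rfl)
    have hz : ∀ x, hsSq G H (Jac (0 : EucM m → EucM n) x) = 0 := by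
      intro x
      have : Jac (0 : EucM m → EucM n) x = 0 := by ext; simp [Jac]
      simp [this, hsSq]
    simpa [hz] using h
  refine ⟨calibPair_le hG hH _, fun a x => ?_, fun hmin => ⟨?_, fun x => ?_⟩, ?_⟩
  · rw [jac_affineTorusMap, periodNorm_eq, Real.mul_self_sqrt (hsSq_nonneg hG hH _)]
    exact calibPair_transpose _
  · exact F 0 - affineTorusMap (P.map Int.cast) 0 0
  · have hA := hasPeriodMatrix_affineTorusMap P 0
    have h := hmin _ (haff 0) (fun x k => ⟨_, hA.add_intVec x k⟩)
      (torusHomotopic_of_hasPeriodMatrix hF (haff 0) hFP hA)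
    rw [henergy hF hFP, haffine, mul_le_mul_iff_right₀ hsqrt, add_le_iff_nonpos_right] at h
    have hu := eq_const_of_integral_hsSq_jac_nonpos hG hH
      (hsub hF)
      (sub_affineTorusMap_periodic hFP 0) h x
    simp only [Pi.sub_apply] at hu
    rw [← hu]
    simp [affineTorusMap]
  · rintro ⟨a, ha⟩ F' hF' - hhom
    rw [funext ha, haffine, henergy hF' (hFP.of_torusHomotopic hhom)]
    gcongr
    exact le_add_of_nonneg_right (integral_nonneg fun x => hsSq_nonneg hG hH _)


end Paper
end
end

section
/- The map f : 𝕋¹ → 𝕋¹ defined by f(x) = x + (1/2π) sin(2πx) is homotopic to the identity and is a (σ₁, ‖P‖^{-1}Φ)-calibrated map for P = 1, even though it is not of the form f(x) = x + a; hence calibrated maps in the torus setting need not be affine. -/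
/-!
Flat tori `𝕋^k = ℝ^k/ℤ^k` are treated via `ℤ^k`-periodic lifts: a smooth map
`f : 𝕋^m → 𝕋^n` is represented by a smooth map `F : ℝ^m → ℝ^n` such that
`F(x + k) − F(x) ∈ ℤ^n` for all `k ∈ ℤ^m`.  The flat metrics `g, h` are given by positive
definite symmetric matrices `G, H`; the induced map on `H¹` is the integer matrix `P` with
`F(x + eᵢ) = F(x) + ᵗP eᵢ`, and the volume form of `g` is `√(det G) dx¹ ∧ ⋯ ∧ dxᵐ`.
For a linear map with matrix `A = dF_x` (size `n × m`), one has
`σ₁(f)(x) = |dF_x| = √(tr(G⁻¹ ᵗA H A))`, and the `m`-form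
`Φ = ∑ h_{jk} P_i^j (*_g dx^i) ∧ dy^k` satisfies `(1,f)^*Φ = tr(G⁻¹ P H A) vol_g`.
-/

noncomputable section
open MeasureTheory
namespace Paper

/-- The lift `F(x) = x + sin(2πx)/(2π)` of the map `f : 𝕋¹ → 𝕋¹`. -/
def sineMap (x : EucM 1) : EucM 1 :=
  x + ((2 * Real.pi)⁻¹ * Real.sin (2 * Real.pi * x 0)) • EuclideanSpace.single 0 (1 : ℝ)

/-- The family `x ↦ x + c sin(2πx)/(2π)` of lifts of self-maps of `𝕋¹`. -/
def scaledSineMap (c : ℝ) (x : EucM 1) : EucM 1 :=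
  x + (c * ((2 * Real.pi)⁻¹ * Real.sin (2 * Real.pi * x 0))) • EuclideanSpace.single 0 (1 : ℝ)

theorem scaledSineMap_zero (x : EucM 1) : scaledSineMap 0 x = x := by
  simp [scaledSineMap]

theorem scaledSineMap_one (x : EucM 1) : scaledSineMap 1 x = sineMap x := by
  simp [scaledSineMap, sineMap]

theorem scaledSineMap_add_intVec (c : ℝ) (x : EucM 1) (kv : Fin 1 → ℤ) :
    scaledSineMap c (x + intVec kv) = scaledSineMap c x + intVec kv := by
  have h : Real.sin (2 * Real.pi * (x + intVec kv) 0) = Real.sin (2 * Real.pi * x 0) := by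
    have hk : (x + intVec kv) 0 = x 0 + kv 0 := rfl
    rw [hk, ← Real.sin_add_int_mul_two_pi (2 * Real.pi * x 0) (kv 0)]
    congr 1
    ring
  rw [scaledSineMap, h, scaledSineMap]
  abel

theorem isTorusMap_scaledSineMap (c : ℝ) : IsTorusMap (scaledSineMap c) :=
  fun x kv => ⟨kv, scaledSineMap_add_intVec c x kv⟩

theorem contDiff_scaledSineMap_one_sub :
    ContDiff ℝ (⊤ : ℕ∞) fun p : ℝ × EucM 1 => scaledSineMap (1 - p.1) p.2 := by
  have h : ContDiff ℝ (⊤ : ℕ∞) fun p : ℝ × EucM 1 => p.2 0 :=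
    (EuclideanSpace.proj 0 : EucM 1 →L[ℝ] ℝ).contDiff.comp contDiff_snd
  unfold scaledSineMap
  fun_prop

theorem contDiff_sineMap : ContDiff ℝ (⊤ : ℕ∞) sineMap := by
  have h := contDiff_scaledSineMap_one_sub.comp
    ((contDiff_const (c := (0 : ℝ))).prodMk (contDiff_id (E := EucM 1)))
  convert h using 1
  funext x
  simp [scaledSineMap_one]

theorem isTorusMap_sineMap : IsTorusMap sineMap := by
  rw [← funext scaledSineMap_one]
  exact isTorusMap_scaledSineMap 1

theorem hasPeriodMatrix_sineMap :
    HasPeriodMatrix sineMap (1 : Matrix (Fin 1) (Fin 1) ℤ) := by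
  intro x i
  have hP : (fun j => (1 : Matrix (Fin 1) (Fin 1) ℤ) i j) = fun j => if j = i then 1 else 0 := by
    funext j
    simp [Matrix.one_apply, eq_comm]
  rw [hP, ← scaledSineMap_one, ← scaledSineMap_one, scaledSineMap_add_intVec]

theorem torusHomotopic_sineMap_id : TorusHomotopic sineMap (id : EucM 1 → EucM 1) :=
  ⟨fun p => scaledSineMap (1 - p.1) p.2, contDiff_scaledSineMap_one_sub,
    fun t => isTorusMap_scaledSineMap (1 - t), fun x => by simp [scaledSineMap_one],
    fun x => by simp [scaledSineMap_zero]⟩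

theorem jac_sineMap (x : EucM 1) :
    Jac sineMap x 0 0 = 1 + Real.cos (2 * Real.pi * x 0) := by
  have hp : HasFDerivAt (fun y : EucM 1 => y 0)
      (EuclideanSpace.proj 0 : EucM 1 →L[ℝ] ℝ) x :=
    (EuclideanSpace.proj 0 : EucM 1 →L[ℝ] ℝ).hasFDerivAt
  have hF : HasFDerivAt sineMap _ x :=
    (hasFDerivAt_id x).add ((((hp.const_mul (2 * Real.pi)).sin).const_mul
      (2 * Real.pi)⁻¹).smul_const (EuclideanSpace.single (0 : Fin 1) (1 : ℝ)))
  rw [Jac, Matrix.of_apply, hF.fderiv]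
  simp
  field_simp

theorem calibPair_one_eq {A : Matrix (Fin 1) (Fin 1) ℝ} (hA : 0 ≤ A 0 0) :
    calibPair (m := 1) (n := 1) 1 1 1 A
      = periodNorm (m := 1) (n := 1) 1 1 1 * Real.sqrt (hsSq (m := 1) (n := 1) 1 1 A) := by
  simp [calibPair, periodNorm, hsSq, Matrix.trace_fin_one, Matrix.mul_apply,
    Real.sqrt_mul_self hA]

theorem sineMap_ne_translation : ¬ ∃ a : EucM 1, ∀ x, sineMap x = x + a := by
  rintro ⟨a, ha⟩
  have h (t : ℝ) : (2 * Real.pi)⁻¹ * Real.sin (2 * Real.pi * t) = a 0 := by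
    simpa [sineMap] using congrArg (fun y : EucM 1 => y 0) (ha (EuclideanSpace.single 0 t))
  have h₀ := h 0
  have h₁ := h 4⁻¹
  rw [show 2 * Real.pi * (4 : ℝ)⁻¹ = Real.pi / 2 by ring, Real.sin_pi_div_two, ← h₀] at h₁
  simp [Real.pi_ne_zero] at h₁

/-- The map `f : 𝕋¹ → 𝕋¹` with lift `F(x) = x + sin(2πx)/(2π)` is a
smooth torus map homotopic to the identity; it is a `(σ₁, ‖P‖⁻¹Φ)`-calibrated map for
`P = 1` (with the standard flat metrics `G = H = 1`), even though it is not of the form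
`f(x) = x + a`.  Hence calibrated maps in the torus setting need not be affine. -/
theorem sine_map_is_calibrated_but_not_affine :
    ContDiff ℝ (⊤ : ℕ∞) sineMap ∧ IsTorusMap sineMap ∧
    HasPeriodMatrix sineMap (1 : Matrix (Fin 1) (Fin 1) ℤ) ∧
    TorusHomotopic sineMap (id : EucM 1 → EucM 1) ∧
    -- `f` is `(σ₁, ‖P‖⁻¹Φ)`-calibrated for `P = 1`, `G = H = 1`
    (∀ x : EucM 1,
      calibPair (m := 1) (n := 1) 1 1 1 (Jac sineMap x)
        = periodNorm (m := 1) (n := 1) 1 1 1 *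
            Real.sqrt (hsSq (m := 1) (n := 1) 1 1 (Jac sineMap x))) ∧
    ¬ ∃ a : EucM 1, ∀ x, sineMap x = x + a :=
  ⟨contDiff_sineMap, isTorusMap_sineMap, hasPeriodMatrix_sineMap, torusHomotopic_sineMap_id,
    fun x => calibPair_one_eq (by
      rw [jac_sineMap]
      linarith [Real.neg_one_le_cos (2 * Real.pi * x 0)]),
    sineMap_ne_translation⟩

end Paper
end
end
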